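/- Let ε be a real number with 1/11 ≤ ε < 1/2, and let p be a prime satisfying log log p > (log 6.83)/(1/2 − ε) and φ(p−1)/(p−1) ≤ 1/2 − ε. Then there exist integers g and x with 1 ≤ g, x ≤ p−1 such that both g and x are QNRNP modulo p and g^x ≡ x (mod p). -/

import Mathlib

/-- An integer `g` is a primitive root modulo `p`: its residue class generates the
multiplicative group of `ℤ/pℤ`, i.e. every nonzero residue is a power of `g`. -/
def IsPrimitiveRootModP (p : ℕ) (g : ℤ) : Prop :=
  ∀ a : ZMod p, a ≠ 0 → ∃ k : ℕ, (g : ZMod p) ^ k = a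

/-- `g` is a quadratic non-residue modulo `p` which is not a primitive root modulo `p`. -/
def IsQNRNP (p : ℕ) (g : ℤ) : Prop :=
  (¬ ∃ x : ℤ, x ^ 2 ≡ g [ZMOD p]) ∧ ¬ IsPrimitiveRootModP p g

open Finset in
theorem sum_norm_sq_stdAddChar {p : ℕ} [Fact p.Prime] {ι : Type*} (s : Finset ι)
    (f : ι → ZMod p) :
    ∑ ξ : ZMod p, ‖∑ i ∈ s, ZMod.stdAddChar (ξ * f i)‖ ^ 2 =
      p * ∑ i ∈ s, (#{j ∈ s | f i = f j} : ℝ) := by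
  have key (z : ℂ) : ((‖z‖ ^ 2 : ℝ) : ℂ) = z * (starRingEnd ℂ) z := by
    rw [Complex.mul_conj, Complex.normSq_eq_norm_sq]
  apply Complex.ofReal_injective
  rw [Complex.ofReal_sum]
  simp_rw [key, map_sum, ← AddChar.map_neg_eq_conj, sum_mul_sum, ← AddChar.map_add_eq_mul,
    ← sub_eq_add_neg, ← mul_sub]
  rw [sum_comm]
  push_cast
  rw [mul_sum]
  refine sum_congr rfl fun i _ => ?_
  rw [sum_comm]
  simp_rw [AddChar.sum_mulShift _ (ZMod.isPrimitive_stdAddChar p), sub_eq_zero, ZMod.card,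
    card_filter]
  push_cast
  rw [mul_sum]
  exact sum_congr rfl fun j _ => by split_ifs <;> simp

open Finset in
theorem card_units_pow_eq_le {F : Type*} [Field F] [Fintype F] [DecidableEq F] {m : ℕ}
    (hm : 0 < m) (w : F) : #{v : Fˣ | (v : F) ^ m = w} ≤ m := by
  calc #{v : Fˣ | (v : F) ^ m = w} ≤ #(Polynomial.nthRootsFinset m w) := by
        refine card_le_card_of_injOn (fun v => (v : F)) (fun v hv => ?_)
          (fun _ _ _ _ h => Units.ext h)
        simp only [coe_filter, mem_univ, true_and, Set.mem_ofPred_eq] at hv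
        simpa [Polynomial.mem_nthRootsFinset hm] using hv
    _ ≤ m := by
        classical
        rw [Polynomial.nthRootsFinset_def]
        exact (Multiset.toFinset_card_le _).trans (Polynomial.card_nthRoots m w)

open Finset in
/-- Square-root cancellation for monomial exponential sums over `ℤ/pℤ`. -/
theorem norm_sq_sum_stdAddChar_pow_le {p : ℕ} [Fact p.Prime] {m : ℕ} (hm : 0 < m)
    {c ξ : ZMod p} (hc : c ≠ 0) (hξ : ξ ≠ 0) :
    ‖∑ u : (ZMod p)ˣ, ZMod.stdAddChar (ξ * (c * (u : ZMod p) ^ m))‖ ^ 2 ≤ p * (m : ℝ) ^ 2 := by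
  set E : ZMod p → ℂ := fun ξ => ∑ u : (ZMod p)ˣ, ZMod.stdAddChar (ξ * (c * (u : ZMod p) ^ m))
    with hE
  have hinv (v : (ZMod p)ˣ) : E (ξ * (v : ZMod p) ^ m) = E ξ := by
    simp only [hE]
    refine Fintype.sum_equiv (Equiv.mulLeft v) _ _ fun u => ?_
    simp only [Equiv.coe_mulLeft, Units.val_mul]
    ring_nf
  have hfib (η : ZMod p) : #{v : (ZMod p)ˣ | ξ * (v : ZMod p) ^ m = η} ≤ m := by
    refine le_trans (card_le_card fun v hv => ?_) (card_units_pow_eq_le hm (η / ξ))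
    simp only [mem_filter, mem_univ, true_and] at hv ⊢
    rw [eq_div_iff hξ, ← hv, mul_comm]
  have hpos : (0 : ℝ) < Fintype.card (ZMod p)ˣ := by exact_mod_cast Fintype.card_pos
  have h₁ : (Fintype.card (ZMod p)ˣ : ℝ) * ‖E ξ‖ ^ 2 ≤ m * ∑ η, ‖E η‖ ^ 2 := by
    calc (Fintype.card (ZMod p)ˣ : ℝ) * ‖E ξ‖ ^ 2
        = ∑ v : (ZMod p)ˣ, ‖E (ξ * (v : ZMod p) ^ m)‖ ^ 2 := by simp [hinv, card_univ]
      _ = ∑ η, ∑ _v ∈ univ.filter fun v : (ZMod p)ˣ => ξ * (v : ZMod p) ^ m = η, ‖E η‖ ^ 2 :=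
          (sum_fiberwise' univ (fun v : (ZMod p)ˣ => ξ * (v : ZMod p) ^ m)
            fun η => ‖E η‖ ^ 2).symm
      _ ≤ ∑ η, m * ‖E η‖ ^ 2 := by
          refine sum_le_sum fun η _ => ?_
          rw [sum_const, nsmul_eq_mul]
          gcongr
          exact_mod_cast hfib η
      _ = _ := (mul_sum ..).symm
  have h₂ : ∑ η, ‖E η‖ ^ 2 ≤ p * (Fintype.card (ZMod p)ˣ * m) := by
    simp only [hE]
    rw [sum_norm_sq_stdAddChar]
    gcongr
    calc _ ≤ ∑ u : (ZMod p)ˣ, (m : ℝ) := by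
          refine sum_le_sum fun u _ => ?_
          exact_mod_cast le_trans (card_le_card fun v hv => by
            simp only [mem_filter, mem_univ, true_and] at hv ⊢
            exact (mul_left_cancel₀ hc hv).symm) (card_units_pow_eq_le hm ((u : ZMod p) ^ m))
      _ = _ := by simp [card_univ]
  refine le_of_mul_le_mul_left ?_ hpos
  calc _ ≤ m * ∑ η, ‖E η‖ ^ 2 := h₁
    _ ≤ m * (p * (Fintype.card (ZMod p)ˣ * m)) := by gcongr
    _ = _ := by ring

open Finset in
/-- The solutions of `a + b = c * u ^ m` with `a ∈ A`, `b ∈ B` and `u` a unit are equidistributed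
up to a square-root error. -/
theorem abs_sum_card_sub_le {p : ℕ} [Fact p.Prime] {m : ℕ} (hm : 0 < m) {c : ZMod p}
    (hc : c ≠ 0) (A B : Finset (ZMod p)) :
    |∑ a ∈ A, ∑ b ∈ B,
        ((#{u : (ZMod p)ˣ | a + b = c * (u : ZMod p) ^ m} : ℝ) - ((p : ℝ) - 1) / p)| ≤
      m * √p * ((#A + #B) / 2) := by
  have hp : (0 : ℝ) < p := by exact_mod_cast (Fact.out : p.Prime).pos
  have hcard : (Fintype.card (ZMod p)ˣ : ℂ) = (p : ℂ) - 1 := by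
    rw [ZMod.card_units, Nat.cast_pred (Fact.out : p.Prime).pos]
  set E : ZMod p → ℂ := fun ξ => ∑ u : (ZMod p)ˣ, ZMod.stdAddChar (ξ * (-c * (u : ZMod p) ^ m))
    with hE
  set S : Finset (ZMod p) → ZMod p → ℂ := fun A ξ => ∑ a ∈ A, ZMod.stdAddChar (ξ * a) with hS
  have hSsum (A : Finset (ZMod p)) : ∑ ξ, ‖S A ξ‖ ^ 2 = p * #A := by
    simp only [hS]
    rw [sum_norm_sq_stdAddChar A fun a => a]
    congr 1
    rw [card_eq_sum_ones, Nat.cast_sum]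
    refine sum_congr rfl fun a ha => ?_
    rw [filter_eq, if_pos ha, card_singleton]
  have hcount : (p : ℂ) * ∑ a ∈ A, ∑ b ∈ B,
      (#{u : (ZMod p)ˣ | a + b = c * (u : ZMod p) ^ m} : ℂ) = ∑ ξ, S A ξ * S B ξ * E ξ := by
    have hexp (ξ : ZMod p) : S A ξ * S B ξ * E ξ = ∑ a ∈ A, ∑ b ∈ B, ∑ u : (ZMod p)ˣ,
        ZMod.stdAddChar (ξ * (a + b + -c * (u : ZMod p) ^ m)) := by
      simp only [hS, hE]
      rw [sum_mul_sum, sum_mul]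
      refine sum_congr rfl fun a _ => ?_
      rw [sum_mul]
      refine sum_congr rfl fun b _ => ?_
      simp_rw [mul_sum, ← AddChar.map_add_eq_mul, ← mul_add]
    simp_rw [hexp]
    rw [mul_sum, sum_comm]
    refine sum_congr rfl fun a _ => ?_
    rw [mul_sum, sum_comm]
    refine sum_congr rfl fun b _ => ?_
    rw [sum_comm]
    simp_rw [AddChar.sum_mulShift _ (ZMod.isPrimitive_stdAddChar p), ZMod.card, card_filter,
      neg_mul, ← sub_eq_add_neg, sub_eq_zero]
    push_cast
    rw [mul_sum]
    exact sum_congr rfl fun u _ => by split_ifs <;> simp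
  have hzero : S A 0 * S B 0 * E 0 = #A * #B * ((p : ℂ) - 1) := by
    simp [hS, hE, ← hcard, card_univ]
  have hmain : (p : ℂ) * ((∑ a ∈ A, ∑ b ∈ B,
        ((#{u : (ZMod p)ˣ | a + b = c * (u : ZMod p) ^ m} : ℝ) - ((p : ℝ) - 1) / p) : ℝ) : ℂ) =
      ∑ ξ ∈ univ.erase 0, S A ξ * S B ξ * E ξ := by
    have hp' : (p : ℂ) ≠ 0 := by exact_mod_cast hp.ne'
    rw [← add_right_inj (S A 0 * S B 0 * E 0),
      add_sum_erase _ (fun ξ => S A ξ * S B ξ * E ξ) (mem_univ 0), ← hcount, hzero]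
    push_cast
    simp only [sum_sub_distrib, sum_const, nsmul_eq_mul, mul_sub]
    field_simp
    ring
  have hbound : ‖∑ ξ ∈ univ.erase 0, S A ξ * S B ξ * E ξ‖ ≤
      p * (m * √p * ((#A + #B) / 2)) := by
    calc _ ≤ ∑ ξ ∈ univ.erase 0, ‖S A ξ * S B ξ * E ξ‖ := norm_sum_le _ _
      _ ≤ ∑ ξ ∈ univ.erase 0, (‖S A ξ‖ ^ 2 + ‖S B ξ‖ ^ 2) / 2 * (m * √p) := by
          refine sum_le_sum fun ξ hξ => ?_
          rw [norm_mul, norm_mul]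
          have hEξ : ‖E ξ‖ ≤ m * √p := by
            refine abs_le_of_sq_le_sq' ?_ (by positivity) |>.2
            rw [mul_pow, Real.sq_sqrt hp.le, mul_comm]
            exact norm_sq_sum_stdAddChar_pow_le hm (neg_ne_zero.2 hc) (ne_of_mem_erase hξ)
          gcongr
          nlinarith [sq_nonneg (‖S A ξ‖ - ‖S B ξ‖)]
      _ ≤ ∑ ξ, (‖S A ξ‖ ^ 2 + ‖S B ξ‖ ^ 2) / 2 * (m * √p) :=
          sum_le_sum_of_subset_of_nonneg (erase_subset _ _) fun _ _ _ => by positivity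
      _ = _ := by
          rw [← sum_mul, ← sum_div, sum_add_distrib, hSsum, hSsum]
          ring
  rw [← hmain, norm_mul, Complex.norm_natCast, Complex.norm_real, Real.norm_eq_abs] at hbound
  exact le_of_mul_le_mul_left hbound hp

open Finset in
theorem abs_sum_ite_dvd_le {p : ℕ} {F : ZMod p → ℝ} {K : ℝ}
    (hF : ∀ A B : Finset (ZMod p), |∑ a ∈ A, ∑ b ∈ B, F (a + b)| ≤ K * (#A + #B))
    {A B : Finset ℕ} (hA : ∀ a ∈ A, a < p) (hB : ∀ b ∈ B, b < p) {d : ℕ} (hd : d ≠ 0) :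
    |∑ a ∈ A, ∑ b ∈ B, if d ∣ a + b then F ((a + b : ℕ) : ZMod p) else 0| ≤ K * (#A + #B) := by
  have : NeZero d := ⟨hd⟩
  have hcast {C : Finset ℕ} (hC : ∀ a ∈ C, a < p) : Set.InjOn (Nat.cast : ℕ → ZMod p) C := by
    intro a ha b hb hab
    rw [ZMod.natCast_eq_natCast_iff'] at hab
    rwa [Nat.mod_eq_of_lt (hC a ha), Nat.mod_eq_of_lt (hC b hb)] at hab
  set A' : ZMod d → Finset ℕ := fun r => {a ∈ A | (a : ZMod d) = r} with hA'
  set B' : ZMod d → Finset ℕ := fun r => {b ∈ B | -(b : ZMod d) = r} with hB'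
  have hsplit : ∑ a ∈ A, ∑ b ∈ B, (if d ∣ a + b then F ((a + b : ℕ) : ZMod p) else 0) =
      ∑ r, ∑ a ∈ A' r, ∑ b ∈ B' r, F ((a + b : ℕ) : ZMod p) := by
    rw [← sum_fiberwise A fun a : ℕ => (a : ZMod d)]
    refine sum_congr rfl fun r _ => sum_congr rfl fun a ha => ?_
    rw [hB', sum_filter]
    refine sum_congr rfl fun b _ => ?_
    rw [← (mem_filter.1 ha).2]
    refine if_congr ?_ rfl rfl
    rw [← ZMod.natCast_eq_zero_iff, Nat.cast_add, add_eq_zero_iff_eq_neg, eq_comm]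
  have hterm (r : ZMod d) : |∑ a ∈ A' r, ∑ b ∈ B' r, F ((a + b : ℕ) : ZMod p)| ≤
      K * (#(A' r) + #(B' r)) := by
    have hA'' : Set.InjOn (Nat.cast : ℕ → ZMod p) (A' r) :=
      hcast fun a ha => hA a (filter_subset _ _ ha)
    have hB'' : Set.InjOn (Nat.cast : ℕ → ZMod p) (B' r) :=
      hcast fun b hb => hB b (filter_subset _ _ hb)
    have := hF ((A' r).image Nat.cast) ((B' r).image Nat.cast)
    rw [card_image_of_injOn hA'', card_image_of_injOn hB'', sum_image hA''] at this
    simp_rw [sum_image hB''] at this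
    simpa only [Nat.cast_add] using this
  rw [hsplit]
  calc _ ≤ ∑ r, |∑ a ∈ A' r, ∑ b ∈ B' r, F ((a + b : ℕ) : ZMod p)| := abs_sum_le_sum_abs _ _
    _ ≤ ∑ r, K * (#(A' r) + #(B' r)) := sum_le_sum fun r _ => hterm r
    _ = _ := by
      rw [← mul_sum, sum_add_distrib, hA', hB',
        card_eq_sum_card_fiberwise (f := fun a : ℕ => (a : ZMod d)) (t := univ) (by simp),
        card_eq_sum_card_fiberwise (s := B) (f := fun b : ℕ => -(b : ZMod d)) (t := univ)
          (by simp)]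
      push_cast
      rfl

open Finset in
theorem ite_forall_not_dvd_eq_sum_powerset {P : Finset ℕ} (hP : ∀ q ∈ P, q.Prime) (x : ℕ) :
    (if ∀ q ∈ P, ¬ q ∣ x then (1 : ℝ) else 0) =
      ∑ S ∈ P.powerset, (-1) ^ #S * if ∏ q ∈ S, q ∣ x then 1 else 0 := by
  have hprod : (if ∀ q ∈ P, ¬ q ∣ x then (1 : ℝ) else 0) =
      ∏ q ∈ P, (1 + -if q ∣ x then 1 else 0) := by
    split_ifs with h
    · exact (prod_eq_one fun q hq => by simp [h q hq]).symm
    · push Not at h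
      obtain ⟨q, hq, hqx⟩ := h
      exact (prod_eq_zero hq (by simp [hqx])).symm
  rw [hprod, prod_one_add]
  refine sum_congr rfl fun S hS => ?_
  rw [prod_neg]
  congr 1
  split_ifs with h
  · exact prod_eq_one fun q hq => if_pos ((dvd_prod_of_mem _ hq).trans h)
  · by_contra hne
    refine h (prod_primes_dvd x (fun q hq => (hP q (mem_powerset.1 hS hq)).prime) fun q hq => ?_)
    by_contra hqx
    exact hne (prod_eq_zero hq (if_neg hqx))

open Finset in
theorem abs_sum_ite_forall_not_dvd_le {p : ℕ} {F : ZMod p → ℝ} {K : ℝ}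
    (hF : ∀ A B : Finset (ZMod p), |∑ a ∈ A, ∑ b ∈ B, F (a + b)| ≤ K * (#A + #B))
    {A B : Finset ℕ} (hA : ∀ a ∈ A, a < p) (hB : ∀ b ∈ B, b < p) {P : Finset ℕ}
    (hP : ∀ q ∈ P, q.Prime) :
    |∑ a ∈ A, ∑ b ∈ B, if ∀ q ∈ P, ¬ q ∣ a + b then F ((a + b : ℕ) : ZMod p) else 0| ≤
      2 ^ #P * (K * (#A + #B)) := by
  have hsplit : ∑ a ∈ A, ∑ b ∈ B,
      (if ∀ q ∈ P, ¬ q ∣ a + b then F ((a + b : ℕ) : ZMod p) else 0) =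
      ∑ S ∈ P.powerset, (-1) ^ #S *
        ∑ a ∈ A, ∑ b ∈ B, if ∏ q ∈ S, q ∣ a + b then F ((a + b : ℕ) : ZMod p) else 0 := by
    symm
    simp_rw [mul_sum]
    rw [sum_comm]
    refine sum_congr rfl fun a _ => ?_
    rw [sum_comm]
    refine sum_congr rfl fun b _ => ?_
    rw [← one_mul (F _), ← zero_mul (F _), ← ite_mul, ite_forall_not_dvd_eq_sum_powerset hP,
      sum_mul]
    refine sum_congr rfl fun S _ => ?_
    split_ifs <;> ring
  rw [hsplit]
  calc _ ≤ ∑ S ∈ P.powerset, |(-1) ^ #S *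
        ∑ a ∈ A, ∑ b ∈ B, if ∏ q ∈ S, q ∣ a + b then F ((a + b : ℕ) : ZMod p) else 0| :=
        abs_sum_le_sum_abs _ _
    _ ≤ ∑ S ∈ P.powerset, K * (#A + #B) := by
        refine sum_le_sum fun S hS => ?_
        rw [abs_mul, abs_pow, abs_neg, abs_one, one_pow, one_mul]
        exact abs_sum_ite_dvd_le hF hA hB
          (prod_ne_zero_iff.2 fun q hq => (hP q (mem_powerset.1 hS hq)).ne_zero)
    _ = _ := by simp [card_powerset]

open Finset in
theorem totient_sub_le_card_coprime (n L b : ℕ) :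
    n.totient - L ≤ #{a ∈ Icc 1 (n - L) | n.Coprime (a + b)} := by
  have hsub : {x ∈ Ico (1 + b) (1 + b + n) | n.Coprime x} ⊆
      ({a ∈ Icc 1 (n - L) | n.Coprime (a + b)}).image (· + b) ∪
        Ico (1 + b + (n - L)) (1 + b + n) := by
    intro x hx
    simp only [mem_filter, mem_Ico] at hx
    simp only [mem_union, mem_image, mem_filter, mem_Icc, mem_Ico]
    by_cases h : 1 + b + (n - L) ≤ x
    · exact Or.inr ⟨h, hx.1.2⟩
    · refine Or.inl ⟨x - b, ⟨⟨by lia, by lia⟩, ?_⟩, by lia⟩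
      rw [Nat.sub_add_cancel (by lia)]
      exact hx.2
  have h₁ := (card_le_card hsub).trans (card_union_le _ _)
  rw [Nat.filter_coprime_Ico_eq_totient, Nat.card_Ico] at h₁
  have h₂ := card_image_le (s := {a ∈ Icc 1 (n - L) | n.Coprime (a + b)}) (f := (· + b))
  lia

open Finset in
theorem exists_coprime_natCast_eq_mul_pow {p : ℕ} [Fact p.Prime] {m : ℕ} (hm : 0 < m)
    {c : ZMod p} (hc : c ≠ 0) (hp : 3 < p)
    (h : 2 * 2 ^ #(p - 1).primeFactors * m * √p * p < ((p - 1).totient : ℝ) ^ 2) :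
    ∃ x : ℕ, 1 ≤ x ∧ x ≤ p - 1 ∧ (p - 1).Coprime x ∧
      ∃ u : (ZMod p)ˣ, (x : ZMod p) = c * (u : ZMod p) ^ m := by
  by_contra! hno
  set n := p - 1 with hn
  obtain ⟨L, hL⟩ := Nat.totient_even (n := n) (by lia)
  have hLφ : L ≤ n.totient - L := by omega
  have hLn : L + L ≤ n := hL ▸ Nat.totient_le n
  set F : ZMod p → ℝ := fun x =>
    (#{u : (ZMod p)ˣ | x = c * (u : ZMod p) ^ m} : ℝ) - ((p : ℝ) - 1) / p with hFdef
  have hp₀ : (0 : ℝ) < p := by exact_mod_cast (by lia : 0 < p)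
  have hn₀ : (0 : ℝ) < n := by exact_mod_cast (by lia : 0 < n)
  have hnp : (p : ℝ) - 1 = n := by rw [hn, Nat.cast_pred (by lia)]
  have hF (A B : Finset (ZMod p)) :
      |∑ a ∈ A, ∑ b ∈ B, F (a + b)| ≤ m * √p / 2 * (#A + #B) :=
    (abs_sum_card_sub_le hm hc A B).trans_eq (by ring)
  have hsieve := abs_sum_ite_forall_not_dvd_le hF (A := Icc 1 (n - L)) (B := range L)
    (fun a ha => by rw [mem_Icc] at ha; lia) (fun b hb => by rw [mem_range] at hb; lia)
    (P := n.primeFactors) fun q hq => Nat.prime_of_mem_primeFactors hq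
  have hcop (x : ℕ) : (∀ q ∈ n.primeFactors, ¬ q ∣ x) ↔ n.Coprime x := by
    refine ⟨fun hx => Nat.coprime_of_dvd fun q hq hqn => hx q ?_, fun hx q hq hqx => ?_⟩
    · exact hq.mem_primeFactors hqn (by lia)
    · exact Nat.not_coprime_of_dvd_of_dvd (Nat.prime_of_mem_primeFactors hq).one_lt
        (Nat.dvd_of_mem_primeFactors hq) hqx hx
  have hsum : ∑ a ∈ Icc 1 (n - L), ∑ b ∈ range L,
      (if ∀ q ∈ n.primeFactors, ¬ q ∣ a + b then F ((a + b : ℕ) : ZMod p) else 0) =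
      -(n / p * ∑ b ∈ range L, (#{a ∈ Icc 1 (n - L) | n.Coprime (a + b)} : ℝ)) := by
    rw [sum_comm, mul_sum, ← sum_neg_distrib]
    refine sum_congr rfl fun b hb => ?_
    rw [card_filter, Nat.cast_sum, mul_sum, ← sum_neg_distrib]
    refine sum_congr rfl fun a ha => ?_
    rw [mem_Icc] at ha
    rw [mem_range] at hb
    simp only [hcop]
    split_ifs with hab
    · have : #{u : (ZMod p)ˣ | ((a + b : ℕ) : ZMod p) = c * (u : ZMod p) ^ m} = 0 := by
        rw [card_eq_zero, filter_eq_empty_iff]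
        exact fun u _ => hno (a + b) (by lia) (by lia) hab u
      simp only [hFdef, this, hnp]
      simp
    · simp
  have hW : (L : ℝ) * L ≤ ∑ b ∈ range L, (#{a ∈ Icc 1 (n - L) | n.Coprime (a + b)} : ℝ) := by
    calc (L : ℝ) * L = ∑ b ∈ range L, (L : ℝ) := by simp
      _ ≤ _ := sum_le_sum fun b _ => by
        exact_mod_cast hLφ.trans (totient_sub_le_card_coprime n L b)
  rw [hsum, abs_neg, abs_of_nonneg (mul_nonneg (div_nonneg hn₀.le hp₀.le)
    (sum_nonneg fun _ _ => Nat.cast_nonneg _))] at hsieve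
  have hcard : ((#(Icc 1 (n - L)) : ℝ) + #(range L)) = n := by
    rw [Nat.card_Icc, card_range, Nat.add_sub_cancel]
    exact_mod_cast Nat.sub_add_cancel (by lia : L ≤ n)
  rw [hcard] at hsieve
  have h₁ : (n : ℝ) / p * (L * L) ≤ 2 ^ #n.primeFactors * (m * √p / 2 * n) :=
    le_trans (by gcongr) hsieve
  have h₂ : (n : ℝ) * (L * L) ≤ n * (2 ^ #n.primeFactors * (m * √p / 2) * p) := by
    rw [div_mul_eq_mul_div, div_le_iff₀ hp₀] at h₁
    linarith
  have h₃ := le_of_mul_le_mul_left h₂ hn₀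
  rw [hL] at h
  push_cast at h
  nlinarith

open Finset in
theorem pow_mul_sixteen_pow_card_primeFactors_le {n : ℕ} (hn : n ≠ 0) :
    n ^ 7 * 16 ^ #n.primeFactors ≤ 183880908800 * n.totient ^ 8 := by
  set K : ℕ → ℕ := fun q =>
    if q = 2 then 2048 else if q = 3 then 137 else if q = 5 then 20 else if q < 23 then 8 else 1
    with hK
  have hKone (q : ℕ) : 1 ≤ K q := by simp only [hK]; split_ifs <;> norm_num
  have hterm (q : ℕ) (hq : q.Prime) : 16 * q ^ 7 ≤ K q * (q - 1) ^ 8 := by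
    rcases lt_or_ge q 23 with h | h
    · interval_cases q <;> first | (norm_num at hq; done) | norm_num [hK]
    · have hKq : K q = 1 := by
        simp only [hK]
        rw [if_neg (by lia), if_neg (by lia), if_neg (by lia), if_neg (by lia)]
      obtain ⟨r, rfl⟩ : ∃ r, q = r + 1 := ⟨q - 1, by lia⟩
      rw [hKq, one_mul, Nat.add_sub_cancel]
      have h₁ : (22 * (r + 1)) ^ 7 ≤ (23 * r) ^ 7 := Nat.pow_le_pow_left (by lia) 7
      have h₂ : 22 * r ^ 7 ≤ r * r ^ 7 := Nat.mul_le_mul_right _ (by lia)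
      rw [mul_pow, mul_pow] at h₁
      rw [pow_succ' r 7]
      lia
  have hKprod : ∏ q ∈ n.primeFactors, K q ≤ 183880908800 := by
    set T : Finset ℕ := {2, 3, 5, 7, 11, 13, 17, 19} with hT
    calc ∏ q ∈ n.primeFactors, K q ≤ ∏ q ∈ T ∪ n.primeFactors, K q :=
          prod_le_prod_of_subset_of_one_le' subset_union_right fun q _ _ => hKone q
      _ = ∏ q ∈ T, K q := by
          refine (prod_subset subset_union_left fun q hq hqT => ?_).symm
          have hq' := Nat.prime_of_mem_primeFactors ((mem_union.1 hq).resolve_left hqT)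
          have h23 : 23 ≤ q := by
            by_contra! h
            interval_cases q <;> first | (norm_num at hq'; done) | simp [hT] at hqT
          simp only [hK]
          rw [if_neg (by lia), if_neg (by lia), if_neg (by lia), if_neg (by lia)]
      _ ≤ 183880908800 := by simp [hT, hK]
  have hprod : 16 ^ #n.primeFactors * (∏ q ∈ n.primeFactors, q) ^ 7 ≤
      183880908800 * (∏ q ∈ n.primeFactors, (q - 1)) ^ 8 := by
    calc _ = ∏ q ∈ n.primeFactors, 16 * q ^ 7 := by
          rw [prod_mul_distrib, prod_const, prod_pow]
      _ ≤ ∏ q ∈ n.primeFactors, K q * (q - 1) ^ 8 :=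
          prod_le_prod' fun q hq => hterm q (Nat.prime_of_mem_primeFactors hq)
      _ ≤ _ := by
          rw [prod_mul_distrib, prod_pow]
          exact Nat.mul_le_mul_right _ hKprod
  have hφ := Nat.totient_mul_prod_primeFactors n
  have hR : ∏ q ∈ n.primeFactors, q ≤ n := Nat.le_of_dvd (by lia) (Nat.prod_primeFactors_dvd n)
  have hRpos : 0 < ∏ q ∈ n.primeFactors, q := prod_pos fun q hq => Nat.pos_of_mem_primeFactors hq
  set R := ∏ q ∈ n.primeFactors, q
  set S := ∏ q ∈ n.primeFactors, (q - 1)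
  refine Nat.le_of_mul_le_mul_left ?_ (by positivity : 0 < n * R ^ 7)
  calc n * R ^ 7 * (n ^ 7 * 16 ^ #n.primeFactors) = n ^ 8 * (16 ^ #n.primeFactors * R ^ 7) := by
        ring
    _ ≤ n ^ 8 * (183880908800 * S ^ 8) := Nat.mul_le_mul_left _ hprod
    _ = 183880908800 * (n * S) ^ 8 := by ring
    _ = 183880908800 * n.totient ^ 8 * R ^ 7 * R := by rw [← hφ]; ring
    _ ≤ 183880908800 * n.totient ^ 8 * R ^ 7 * n := Nat.mul_le_mul_left _ hR
    _ = _ := by ring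

open Finset in
theorem one_sub_sum_le_prod_one_sub {ι : Type*} (s : Finset ι) (f : ι → ℝ)
    (h₀ : ∀ i ∈ s, 0 ≤ f i) (h₁ : ∀ i ∈ s, f i ≤ 1) :
    1 - ∑ i ∈ s, f i ≤ ∏ i ∈ s, (1 - f i) := by
  classical
  induction s using Finset.induction_on with
  | empty => simp
  | insert a s ha ih =>
    rw [sum_insert ha, prod_insert ha]
    have hih := ih (fun i hi => h₀ i (mem_insert_of_mem hi)) fun i hi => h₁ i (mem_insert_of_mem hi)
    have ha₀ := h₀ a (mem_insert_self a s)
    have ha₁ := h₁ a (mem_insert_self a s)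
    have hs : 0 ≤ ∑ i ∈ s, f i := sum_nonneg fun i hi => h₀ i (mem_insert_of_mem hi)
    nlinarith [mul_le_mul_of_nonneg_left hih (sub_nonneg.2 ha₁), mul_nonneg ha₀ hs]

open Finset in
theorem exists_odd_prime_dvd_le_of_totient_le {n : ℕ} (hn : n ≠ 0) (h2 : 2 ∣ n)
    (h : (n.totient : ℝ) ≤ 9 / 22 * n) :
    ∃ l : ℕ, l.Prime ∧ l ≠ 2 ∧ l ∣ n ∧ 2 * l ≤ 11 * #n.primeFactors := by
  by_contra! hno
  have hn₀ : (0 : ℝ) < n := by exact_mod_cast Nat.pos_of_ne_zero hn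
  have h2mem : 2 ∈ n.primeFactors := Nat.prime_two.mem_primeFactors h2 hn
  set k := #n.primeFactors with hk
  have hk₀ : (0 : ℝ) < k := by exact_mod_cast card_pos.2 ⟨2, h2mem⟩
  have hφ : (n.totient : ℝ) = n * ∏ q ∈ n.primeFactors, (1 - (q : ℝ)⁻¹) := by
    simpa using congrArg (Rat.cast : ℚ → ℝ) (Nat.totient_eq_mul_prod_factors n)
  rw [← mul_prod_erase _ _ h2mem] at hφ
  have hprod := one_sub_sum_le_prod_one_sub (n.primeFactors.erase 2) (fun q => (q : ℝ)⁻¹)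
    (fun q _ => by positivity) fun q hq => inv_le_one_of_one_le₀ <| by
      exact_mod_cast (Nat.prime_of_mem_primeFactors (mem_of_mem_erase hq)).one_le
  have hsum : ∑ q ∈ n.primeFactors.erase 2, (q : ℝ)⁻¹ ≤ (k - 1) * (2 / (11 * k)) := by
    calc _ ≤ ∑ q ∈ n.primeFactors.erase 2, 2 / (11 * k : ℝ) := by
          refine sum_le_sum fun q hq => ?_
          have hq' := mem_of_mem_erase hq
          have hlt : (11 * k : ℝ) < 2 * q := by
            exact_mod_cast hno q (Nat.prime_of_mem_primeFactors hq') (ne_of_mem_erase hq)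
              (Nat.dvd_of_mem_primeFactors hq')
          rw [inv_eq_one_div, div_le_div_iff₀ (by linarith) (by positivity)]
          linarith
      _ = _ := by
          rw [sum_const, nsmul_eq_mul, card_erase_of_mem h2mem, ← hk,
            Nat.cast_pred (card_pos.2 ⟨2, h2mem⟩)]
  have hlt : ((k : ℝ) - 1) * (2 / (11 * k)) < 2 / 11 := by
    rw [mul_div_assoc', div_lt_div_iff₀ (by positivity) (by norm_num)]
    linarith
  rw [hφ] at h
  have h' : (n : ℝ) * ((1 - ((2 : ℕ) : ℝ)⁻¹) * (9 / 11)) <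
      n * ((1 - ((2 : ℕ) : ℝ)⁻¹) * ∏ q ∈ n.primeFactors.erase 2, (1 - (q : ℝ)⁻¹)) := by
    gcongr
    linarith
  norm_num at h h'
  linarith

open Finset in
theorem two_pow_card_primeFactors_le {n : ℕ} (hn : n ≠ 0) : 2 ^ #n.primeFactors ≤ n :=
  (pow_card_le_prod _ _ _ fun _ hq => (Nat.prime_of_mem_primeFactors hq).two_le).trans
    (Nat.le_of_dvd (Nat.pos_of_ne_zero hn) (Nat.prod_primeFactors_dvd n))

theorem two_pow_mul_pow_four_lt {n k : ℕ} (hn : 2 ^ 100 ≤ n) (hk : 2 ^ k ≤ n) :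
    2 ^ 62 * k ^ 4 < n := by
  rcases le_total k 100 with h | h
  · calc 2 ^ 62 * k ^ 4 ≤ 2 ^ 62 * 100 ^ 4 := by gcongr
      _ < 2 ^ 100 := by norm_num
      _ ≤ n := hn
  · refine lt_of_lt_of_le ?_ hk
    induction k, h using Nat.le_induction with
    | base => norm_num
    | succ k h ih =>
      have ih' := ih (le_trans (Nat.pow_le_pow_right (by norm_num) (by lia)) hk)
      have hstep : (k + 1) ^ 4 ≤ 2 * k ^ 4 := by
        have h₁ : (100 * (k + 1)) ^ 4 ≤ (101 * k) ^ 4 := Nat.pow_le_pow_left (by lia) 4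
        rw [mul_pow, mul_pow] at h₁
        lia
      rw [pow_succ 2 k]
      lia

open Finset in
theorem sieve_error_lt {p : ℕ} (hp : 2 ^ 100 < p) {m : ℕ}
    (hm : m ≤ 11 * #(p - 1).primeFactors) :
    2 * 2 ^ #(p - 1).primeFactors * m * √p * p < ((p - 1).totient : ℝ) ^ 2 := by
  obtain ⟨n, rfl⟩ : ∃ n, p = n + 1 := ⟨p - 1, by lia⟩
  rw [Nat.add_sub_cancel] at *
  have hn : 2 ^ 100 ≤ n := by lia
  have hn₀ : 0 < n := lt_of_lt_of_le (by norm_num) hn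
  set k := #n.primeFactors
  have hk : 2 ^ 62 * k ^ 4 < n :=
    two_pow_mul_pow_four_lt hn (two_pow_card_primeFactors_le hn₀.ne')
  have hφ : n ^ 7 * 16 ^ k ≤ 183880908800 * n.totient ^ 8 :=
    pow_mul_sixteen_pow_card_primeFactors_le hn₀.ne'
  have hmain : 16 * 16 ^ k * m ^ 4 * (n + 1) ^ 6 < n.totient ^ 8 := by
    by_contra! hcon
    have h₁ : n ^ 7 * 16 ^ k < n ^ 7 * 16 ^ k := by
      calc n ^ 7 * 16 ^ k ≤ 183880908800 * n.totient ^ 8 := hφ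
        _ ≤ 183880908800 * (16 * 16 ^ k * m ^ 4 * (n + 1) ^ 6) := Nat.mul_le_mul_left _ hcon
        _ ≤ 183880908800 * (16 * 16 ^ k * (11 * k) ^ 4 * (2 * n) ^ 6) := by
          gcongr
          lia
        _ = 183880908800 * 16 * 14641 * 64 * k ^ 4 * (n ^ 6 * 16 ^ k) := by ring
        _ ≤ 2 ^ 62 * k ^ 4 * (n ^ 6 * 16 ^ k) := by
          gcongr
          norm_num
        _ < n * (n ^ 6 * 16 ^ k) := Nat.mul_lt_mul_of_pos_right hk (by positivity)
        _ = n ^ 7 * 16 ^ k := by ring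
    exact lt_irrefl _ h₁
  refine lt_of_pow_lt_pow_left₀ 4 (by positivity) ?_
  have hsqrt : √((n + 1 : ℕ) : ℝ) ^ 4 = ((n + 1 : ℕ) : ℝ) ^ 2 := by
    rw [show 4 = 2 * 2 from rfl, pow_mul, Real.sq_sqrt (Nat.cast_nonneg _)]
  calc (2 * 2 ^ k * m * √((n + 1 : ℕ) : ℝ) * ((n + 1 : ℕ) : ℝ)) ^ 4
      = 16 * (2 ^ 4) ^ k * m ^ 4 * √((n + 1 : ℕ) : ℝ) ^ 4 * ((n + 1 : ℕ) : ℝ) ^ 4 := by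
        rw [← pow_mul, mul_comm 4 k, pow_mul]; ring
    _ = ((16 * 16 ^ k * m ^ 4 * (n + 1) ^ 6 : ℕ) : ℝ) := by
        rw [hsqrt]; push_cast; norm_num; ring
    _ < ((n.totient ^ 8 : ℕ) : ℝ) := Nat.cast_lt.2 hmain
    _ = ((n.totient : ℝ) ^ 2) ^ 4 := by push_cast; ring

theorem two_pow_lt_of_log_log_gt {ε : ℝ} (hε₁ : 1 / 11 ≤ ε) (hε₂ : ε < 1 / 2) {p : ℕ}
    (hp : 1 < p) (hlog : Real.log (Real.log p) > Real.log 6.83 / (1 / 2 - ε)) : 2 ^ 100 < p := by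
  have hp₀ : (0 : ℝ) < p := by exact_mod_cast (by lia : 0 < p)
  have hlogp : 0 < Real.log p := Real.log_pos (by exact_mod_cast hp)
  have hlog₀ : 0 < Real.log 6.83 := Real.log_pos (by norm_num)
  have h₁ : 9 / 4 * Real.log 6.83 ≤ Real.log 6.83 / (1 / 2 - ε) := by
    rw [le_div_iff₀ (by linarith)]
    nlinarith
  have h₂ : Real.log (6.83 ^ 9) < Real.log (Real.log p ^ 4) := by
    rw [Real.log_pow, Real.log_pow]
    push_cast
    linarith
  have h₃ : (70 : ℝ) ^ 4 < Real.log p ^ 4 :=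
    lt_of_le_of_lt (by norm_num) ((Real.log_lt_log_iff (by norm_num) (by positivity)).1 h₂)
  have h₄ : 70 < Real.log p := lt_of_pow_lt_pow_left₀ 4 hlogp.le h₃
  have h₅ : Real.log (2 ^ 100) < Real.log p := by
    rw [Real.log_pow]
    push_cast
    linarith [Real.log_two_lt_d9]
  exact_mod_cast (Real.log_lt_log_iff (by norm_num) hp₀).1 h₅

theorem isQNRNP_of_eq_mul_pow {p : ℕ} [Fact p.Prime] {l : ℕ} (hl : l.Prime) (hl2 : l ≠ 2)
    (hlp : l ∣ p - 1) {g₀ : ZMod p} (hg₀ : ¬ IsSquare g₀) {x : ℕ} {u : (ZMod p)ˣ}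
    (hx : (x : ZMod p) = g₀ ^ l * (u : ZMod p) ^ (2 * l)) : IsQNRNP p x := by
  have hg₀' : g₀ ≠ 0 := by
    rintro rfl
    exact hg₀ IsSquare.zero
  constructor
  · rintro ⟨y, hy⟩
    obtain ⟨j, hj⟩ := hl.odd_of_ne_two hl2
    have hy' : (y : ZMod p) ^ 2 = x := by
      simpa using (ZMod.intCast_eq_intCast_iff _ _ _).2 hy
    refine hg₀ ⟨y / (g₀ ^ j * (u : ZMod p) ^ l), ?_⟩
    have hd : g₀ ^ j * (u : ZMod p) ^ l ≠ 0 :=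
      mul_ne_zero (pow_ne_zero _ hg₀') (pow_ne_zero _ u.ne_zero)
    have hpow : g₀ ^ l = g₀ ^ (2 * j + 1) := congrArg (g₀ ^ ·) hj
    rw [div_mul_div_comm, ← sq (y : ZMod p), hy', hx, hpow, eq_div_iff (mul_ne_zero hd hd)]
    ring
  · intro hprim
    set t := (p - 1) / l with ht
    have hp₀ : 0 < p - 1 := Nat.sub_pos_of_lt (Fact.out : p.Prime).one_lt
    have ht₀ : 0 < t := Nat.div_pos (Nat.le_of_dvd hp₀ hlp) hl.pos
    have htlt : t < p - 1 := Nat.div_lt_self hp₀ hl.one_lt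
    have hxt : (x : ZMod p) ^ t = 1 := by
      have hw : (x : ZMod p) = (g₀ * (u : ZMod p) ^ 2) ^ l := by rw [hx]; ring
      rw [hw, ← pow_mul, ht, Nat.mul_div_cancel' hlp]
      exact ZMod.pow_card_sub_one_eq_one (mul_ne_zero hg₀' (pow_ne_zero _ u.ne_zero))
    have hcard := card_units_pow_eq_le ht₀ (1 : ZMod p)
    rw [Finset.filter_true_of_mem, Finset.card_univ, ZMod.card_units] at hcard
    · lia
    · intro v _
      obtain ⟨k, hk⟩ := hprim v v.ne_zero
      rw [← hk, Int.cast_natCast, ← pow_mul, mul_comm, pow_mul, hxt, one_pow]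

/-- A QNRNP exponent coprime to `p - 1` is the discrete logarithm of itself to a QNRNP base. -/
theorem exists_isQNRNP_pow_modEq {p : ℕ} [Fact p.Prime] (hp : 2 < p) {x : ℕ} (hx₁ : 1 ≤ x)
    (hx₂ : x ≤ p - 1) (hx : (p - 1).Coprime x) (hxQ : IsQNRNP p x) :
    ∃ g : ℕ, 1 ≤ g ∧ g ≤ p - 1 ∧ IsQNRNP p g ∧ (g : ℤ) ^ x ≡ (x : ℤ) [ZMOD p] := by
  obtain ⟨y, -, hy⟩ := Nat.exists_mul_mod_eq_one_of_coprime hx.symm (by lia)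
  have hx₀ : (x : ZMod p) ≠ 0 := by
    rw [Ne, ZMod.natCast_eq_zero_iff]
    exact fun h => by have := Nat.le_of_dvd hx₁ h; lia
  have hxy : ((x : ZMod p) ^ y) ^ x = x := by
    rw [← pow_mul, mul_comm, ← Nat.div_add_mod (x * y) (p - 1), hy, pow_succ, pow_mul,
      ZMod.pow_card_sub_one_eq_one hx₀, one_pow, one_mul]
  have hval : ((((x : ZMod p) ^ y).val : ℕ) : ZMod p) = (x : ZMod p) ^ y :=
    ZMod.natCast_zmod_val _
  have hmod : ((((x : ZMod p) ^ y).val : ℕ) : ℤ) ^ x ≡ (x : ℤ) [ZMOD p] := by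
    rw [← ZMod.intCast_eq_intCast_iff]
    push_cast
    rw [hval, hxy]
  refine ⟨((x : ZMod p) ^ y).val, ?_, ?_, ⟨?_, ?_⟩, hmod⟩
  · exact Nat.pos_of_ne_zero fun h => pow_ne_zero y hx₀ ((ZMod.val_eq_zero _).1 h)
  · exact Nat.le_sub_one_of_lt (ZMod.val_lt _)
  · rintro ⟨z, hz⟩
    refine hxQ.1 ⟨z ^ x, ?_⟩
    rw [← pow_mul, mul_comm, pow_mul]
    exact (hz.pow x).trans hmod
  · intro hprim
    refine hxQ.2 fun a ha => ?_
    obtain ⟨k, hk⟩ := hprim a ha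
    refine ⟨y * k, ?_⟩
    rw [← hk, Int.cast_natCast, Int.cast_natCast, hval, pow_mul]

theorem stmt2 (ε : ℝ) (hε₁ : 1 / 11 ≤ ε) (hε₂ : ε < 1 / 2)
    (p : ℕ) (hp : p.Prime)
    (hlog : Real.log (Real.log p) > Real.log 6.83 / (1 / 2 - ε))
    (hphi : ((p - 1 : ℕ).totient : ℝ) / ((p : ℝ) - 1) ≤ 1 / 2 - ε) :
    ∃ g x : ℕ, 1 ≤ g ∧ g ≤ p - 1 ∧ 1 ≤ x ∧ x ≤ p - 1 ∧
      IsQNRNP p (g : ℤ) ∧ IsQNRNP p (x : ℤ) ∧ (g : ℤ) ^ x ≡ (x : ℤ) [ZMOD p] := by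
  have : Fact p.Prime := ⟨hp⟩
  have hbig := two_pow_lt_of_log_log_gt hε₁ hε₂ hp.one_lt hlog
  have hp3 : 3 < p := lt_trans (by norm_num) hbig
  have hpred : ((p - 1 : ℕ) : ℝ) = (p : ℝ) - 1 := Nat.cast_pred hp.pos
  have hpos : (0 : ℝ) < (p : ℝ) - 1 := by
    rw [← hpred]
    exact_mod_cast (by lia : 0 < p - 1)
  have htot : ((p - 1).totient : ℝ) ≤ 9 / 22 * (p - 1 : ℕ) := by
    rw [hpred, ← div_le_iff₀ hpos]
    linarith
  obtain ⟨l, hl, hl2, hlp, hlk⟩ := exists_odd_prime_dvd_le_of_totient_le (by lia)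
    (hp.even_sub_one (by lia)).two_dvd htot
  obtain ⟨g₀, hg₀⟩ := FiniteField.exists_nonsquare (F := ZMod p)
    (by rw [ZMod.ringChar_zmod_n]; lia)
  have hg₀' : g₀ ≠ 0 := by
    rintro rfl
    exact hg₀ IsSquare.zero
  obtain ⟨x, hx₁, hx₂, hcop, u, hu⟩ := exists_coprime_natCast_eq_mul_pow
    (Nat.mul_pos two_pos hl.pos) (pow_ne_zero l hg₀') hp3 (sieve_error_lt hbig hlk)
  have hxQ := isQNRNP_of_eq_mul_pow hl hl2 hlp hg₀ hu
  obtain ⟨g, hg₁, hg₂, hgQ, hgx⟩ := exists_isQNRNP_pow_modEq (by lia) hx₁ hx₂ hcop hxQ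
  exact ⟨g, x, hg₁, hg₂, hx₁, hx₂, hgQ, hxQ, hgx⟩
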